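/- arXiv:math/0401306 — 2 statements merged into one kernel-verified Lean document; each statement's English description precedes it below -/
import Mathlib

section
/- Let (R, m) be a local Noetherian ring, let J ⊆ R be an ideal and let c, x ∈ R. Assume that the ideal (J, cx) is primary to the maximal ideal m. Then for every i ≥ 0 one has λ(H_i(J, c)) = λ(ann_c H_i(J, cx)), where H_i(J, c) denotes the i-th Koszul homology of a generating set of J together with the element c, H_i(J, cx) denotes the i-th Koszul homology of the same generating set of J together with cx, and ann_c M = {u ∈ M : cu = 0} for an R-module M. -/
/-- `x` is integral over the ideal `I`: it satisfies an equation
`x^m + b_1 x^{m-1} + ... + b_m = 0` with `b_j ∈ I^j` and `m ≥ 1`. -/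
def Ideal.IsIntegralElem' {R : Type*} [CommRing R] (I : Ideal R) (x : R) : Prop :=
  ∃ m : ℕ, 0 < m ∧ ∃ b : ℕ → R, (∀ j, 1 ≤ j → j ≤ m → b j ∈ I ^ j) ∧
    x ^ m + ∑ j ∈ Finset.Icc 1 m, b j * x ^ (m - j) = 0

/-- The integral closure of an ideal, as an ideal.  (Since the set of elements integral
over `I` is an ideal, taking the span adds nothing.) -/
def Ideal.intClosure {R : Type*} [CommRing R] (I : Ideal R) : Ideal R :=
  Ideal.span {x | I.IsIntegralElem' x}

/-- An ideal is integrally closed if it contains every element integral over it. -/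
def Ideal.IsIntClosed {R : Type*} [CommRing R] (I : Ideal R) : Prop :=
  ∀ x, I.IsIntegralElem' x → x ∈ I

/-- The minimal number of generators of an ideal. -/
noncomputable def Ideal.mu {R : Type*} [CommRing R] (I : Ideal R) : ℕ :=
  sInf {n | ∃ f : Fin n → R, Ideal.span (Set.range f) = I}
section Koszul

variable {R : Type*} [CommRing R] {n : ℕ}

/-- The linear functional on `Fin n → R` determined by the sequence `a`. -/
noncomputable def koszulDual (a : Fin n → R) : Module.Dual R (Fin n → R) :=
  ∑ j, a j • LinearMap.proj j

/-- The Koszul differential on the exterior algebra of `Fin n → R`: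
contraction with the dual element determined by `a`. -/
noncomputable def koszulDiff (a : Fin n → R) :
    ExteriorAlgebra R (Fin n → R) →ₗ[R] ExteriorAlgebra R (Fin n → R) :=
  CliffordAlgebra.contractLeft (koszulDual a)

/-- The `i`-th graded piece of the exterior algebra of `Fin n → R`, i.e. the `i`-th
term of the Koszul complex. -/
noncomputable def koszulPiece (R : Type*) [CommRing R] (n i : ℕ) :
    Submodule R (ExteriorAlgebra R (Fin n → R)) :=
  LinearMap.range (ExteriorAlgebra.ι R (M := Fin n → R)) ^ i

/-- The `i`-cycles of the Koszul complex of the sequence `a`. -/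
noncomputable def koszulCycles (a : Fin n → R) (i : ℕ) :
    Submodule R (ExteriorAlgebra R (Fin n → R)) :=
  koszulPiece R n i ⊓ LinearMap.ker (koszulDiff a)

/-- The `i`-boundaries of the Koszul complex of the sequence `a`. -/
noncomputable def koszulBoundaries (a : Fin n → R) (i : ℕ) :
    Submodule R (ExteriorAlgebra R (Fin n → R)) :=
  Submodule.map (koszulDiff a) (koszulPiece R n (i + 1))

/-- The `i`-th Koszul homology module `H_i(a)` of the sequence `a`. -/
noncomputable def koszulHomology (a : Fin n → R) (i : ℕ) : Type _ :=
  koszulCycles a i ⧸ (koszulBoundaries a i).comap (koszulCycles a i).subtype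

noncomputable instance (a : Fin n → R) (i : ℕ) : AddCommGroup (koszulHomology a i) :=
  inferInstanceAs (AddCommGroup
    (koszulCycles a i ⧸ (koszulBoundaries a i).comap (koszulCycles a i).subtype))

noncomputable instance (a : Fin n → R) (i : ℕ) : Module R (koszulHomology a i) :=
  inferInstanceAs (Module R
    (koszulCycles a i ⧸ (koszulBoundaries a i).comap (koszulCycles a i).subtype))

/-- The annihilator ideal of the `i`-th Koszul homology of `a`. -/
noncomputable def koszulAnn (a : Fin n → R) (i : ℕ) : Ideal R :=
  Module.annihilator R (koszulHomology a i)

end Koszul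

/-- `a` is a minimal generating sequence for the ideal `I`. -/
def IsMinGen {R : Type*} [CommRing R] {n : ℕ} (a : Fin n → R) (I : Ideal R) : Prop :=
  Ideal.span (Set.range a) = I ∧ n = I.mu

/-- The length of a module, as the Krull dimension of its lattice of submodules
(the longest chain of submodules). -/
noncomputable def moduleLength (R M : Type*) [CommRing R] [AddCommGroup M] [Module R M] :
    WithBot ℕ∞ :=
  Order.krullDim (Submodule R M)

section SubquotientLength

variable {R E F Q : Type*} [CommRing R] [AddCommGroup E] [Module R E]
  [AddCommGroup F] [Module R F] [AddCommGroup Q] [Module R Q]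

/-- The length of the subquotient `A / (A ⊓ B)`. -/
noncomputable def Submodule.relLength (A B : Submodule R E) : ℕ∞ :=
  Module.length R (A ⧸ B.comap A.subtype)

theorem Submodule.relLength_eq_of_surjective (A B : Submodule R E) (g : A →ₗ[R] Q)
    (hg : Function.Surjective g) (hker : ∀ a : A, g a = 0 ↔ (a : E) ∈ B) :
    A.relLength B = Module.length R Q := by
  have h : B.comap A.subtype = LinearMap.ker g := by
    ext a
    simp [hker]
  rw [relLength, h]
  exact (g.quotKerEquivOfSurjective hg).length_eq

/-- Additivity of length along the restriction of a linear map to a subquotient. -/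
theorem Submodule.relLength_eq_add (f : E →ₗ[R] F) {A B : Submodule R E} (hBA : B ≤ A) :
    A.relLength B = (A ⊓ LinearMap.ker f).relLength (B ⊓ LinearMap.ker f) +
      (A.map f).relLength (B.map f) := by
  refine Module.length_eq_add_of_exact
    (Submodule.mapQ _ _ (Submodule.inclusion inf_le_left) ?_)
    (Submodule.mapQ _ _ (f.submoduleMap A) ?_) ?_ ?_ ?_
  · rintro ⟨a, ha⟩ h
    simp at h ⊢
    exact h.1
  · rintro ⟨a, ha⟩ h
    simp at h ⊢
    exact ⟨a, h, rfl⟩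
  · rw [injective_iff_map_eq_zero]
    intro q
    obtain ⟨⟨a, ha⟩, rfl⟩ := Submodule.mkQ_surjective _ q
    intro h
    simp only [Submodule.mkQ_apply, Submodule.mapQ_apply, Submodule.Quotient.mk_eq_zero,
      Submodule.mem_comap, Submodule.subtype_apply] at h ⊢
    exact ⟨h, ha.2⟩
  · intro q
    obtain ⟨⟨y, a, ha, rfl⟩, rfl⟩ := Submodule.mkQ_surjective _ q
    exact ⟨Submodule.mkQ _ ⟨a, ha⟩, rfl⟩
  · intro q
    obtain ⟨⟨a, ha⟩, rfl⟩ := Submodule.mkQ_surjective _ q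
    simp only [Submodule.mkQ_apply, Submodule.mapQ_apply, Submodule.Quotient.mk_eq_zero,
      Submodule.mem_comap, Submodule.subtype_apply, Set.mem_range]
    constructor
    · rintro ⟨y, hy, hya⟩
      replace hya : f y = f a := hya
      refine ⟨Submodule.mkQ _ ⟨a - y, A.sub_mem ha (hBA hy), ?_⟩, ?_⟩
      · simp [hya]
      · simp only [Submodule.mkQ_apply, Submodule.mapQ_apply]
        rw [Submodule.Quotient.eq]
        simpa using hy
    · rintro ⟨q, hq⟩
      obtain ⟨⟨y, hy⟩, rfl⟩ := Submodule.mkQ_surjective _ q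
      simp only [Submodule.mkQ_apply, Submodule.mapQ_apply] at hq
      rw [Submodule.Quotient.eq] at hq
      have hq' : y - a ∈ B := hq
      refine ⟨a - y, by simpa using B.neg_mem hq', ?_⟩
      have : f y = 0 := hy.2
      simp [this]

theorem Module.length_ker_eq_length_coker (f : Q →ₗ[R] Q) (h : Module.length R Q ≠ ⊤) :
    Module.length R (LinearMap.ker f) = Module.length R (Q ⧸ LinearMap.range f) := by
  have h₁ := Module.length_eq_add_of_exact (LinearMap.ker f).subtype f.rangeRestrict
    (Submodule.subtype_injective _) f.surjective_rangeRestrict (by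
      rw [LinearMap.exact_iff, LinearMap.ker_rangeRestrict, Submodule.range_subtype])
  have h₂ := Module.length_eq_add_of_exact (LinearMap.range f).subtype (LinearMap.range f).mkQ
    (Submodule.subtype_injective _) (Submodule.mkQ_surjective _) (LinearMap.exact_subtype_mkQ _)
  have h₃ : Module.length R (LinearMap.range f) ≠ ⊤ := fun h' => h (by rw [h₂, h', top_add])
  rw [h₂, add_comm] at h₁
  exact (ENat.add_left_injective_of_ne_top h₃ h₁).symm

/-- The part of the subquotient `A / B` killed by `c`, as a subquotient. -/
theorem Submodule.relLength_inf_comap_lsmul (A B : Submodule R E) (c : R) :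
    (A ⊓ B.comap (LinearMap.lsmul R E c)).relLength B =
      Module.length R (LinearMap.ker (LinearMap.lsmul R (A ⧸ B.comap A.subtype) c)) := by
  refine Submodule.relLength_eq_of_surjective _ _
    (LinearMap.codRestrict _ ((B.comap A.subtype).mkQ ∘ₗ Submodule.inclusion inf_le_left) ?_)
    ?_ ?_
  · rintro ⟨a, ha, hc⟩
    rw [LinearMap.mem_ker, LinearMap.lsmul_apply, LinearMap.comp_apply, ← map_smul,
      Submodule.mkQ_apply, Submodule.Quotient.mk_eq_zero]
    exact hc
  · rintro ⟨q, hq⟩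
    obtain ⟨⟨a, ha⟩, rfl⟩ := Submodule.mkQ_surjective _ q
    rw [LinearMap.mem_ker, LinearMap.lsmul_apply, ← map_smul,
      Submodule.mkQ_apply, Submodule.Quotient.mk_eq_zero] at hq
    exact ⟨⟨a, ha, hq⟩, rfl⟩
  · rintro ⟨a, ha⟩
    rw [← Subtype.coe_inj]
    simp [Submodule.Quotient.mk_eq_zero]

theorem Submodule.relLength_sup_map_lsmul (A B : Submodule R E) (c : R)
    (h : A.relLength B ≠ ⊤) :
    A.relLength (B ⊔ A.map (LinearMap.lsmul R E c)) =
      (A ⊓ B.comap (LinearMap.lsmul R E c)).relLength B := by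
  rw [Submodule.relLength_inf_comap_lsmul A B, Module.length_ker_eq_length_coker _ h]
  refine Submodule.relLength_eq_of_surjective _ _
    ((LinearMap.range (LinearMap.lsmul R (A ⧸ B.comap A.subtype) c)).mkQ ∘ₗ
      (B.comap A.subtype).mkQ)
    ((Submodule.mkQ_surjective _).comp (Submodule.mkQ_surjective _)) ?_
  rintro ⟨a, ha⟩
  rw [LinearMap.comp_apply, Submodule.mkQ_apply, Submodule.Quotient.mk_eq_zero,
    LinearMap.mem_range]
  constructor
  · rintro ⟨q, hq⟩
    obtain ⟨⟨y, hy⟩, rfl⟩ := Submodule.mkQ_surjective _ q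
    rw [LinearMap.lsmul_apply, ← map_smul, Submodule.mkQ_apply, Submodule.mkQ_apply,
      Submodule.Quotient.eq] at hq
    have hq' : c • y - a ∈ B := hq
    rw [Submodule.mem_sup]
    exact ⟨_, B.neg_mem hq', c • y, ⟨y, hy, rfl⟩, by simp⟩
  · intro hmem
    obtain ⟨w, hw, _, ⟨y, hy, rfl⟩, rfl⟩ := Submodule.mem_sup.mp hmem
    refine ⟨Submodule.mkQ _ ⟨y, hy⟩, ?_⟩
    rw [LinearMap.lsmul_apply, ← map_smul, Submodule.mkQ_apply, Submodule.mkQ_apply,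
      Submodule.Quotient.eq]
    simpa using hw

end SubquotientLength

section ConeComplex

variable {R E : Type*} [CommRing R] [AddCommGroup E] [Module R E]

/-- Anticommuting differentials `D` and `δ` on a module, with `e` contracting `δ` and
anticommuting with `D`, together with three consecutive graded pieces. Then `D + c • δ` is the
differential of the cone of multiplication by `c` on the complex `(ker δ, D)`. -/
structure IsCone (D δ e : E →ₗ[R] E) (Pm P Pp : Submodule R E) : Prop where
  DD : ∀ w, D (D w) = 0
  δδ : ∀ w, δ (δ w) = 0
  δD : ∀ w, δ (D w) = -D (δ w)
  δe : ∀ w, δ (e w) = w - e (δ w)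
  De : ∀ w, D (e w) = -e (D w)
  δ_mem : ∀ w ∈ P, δ w ∈ Pm
  δ_mem_succ : ∀ w ∈ Pp, δ w ∈ P
  D_mem_succ : ∀ w ∈ Pp, D w ∈ P
  e_mem : ∀ w ∈ Pm, e w ∈ P
  e_mem_succ : ∀ w ∈ P, e w ∈ Pp

namespace IsCone

variable {D δ e : E →ₗ[R] E} {Pm P Pp : Submodule R E} (h : IsCone D δ e Pm P Pp)
include h

theorem boundaries_le_cycles (c : R) :
    Pp.map (D + c • δ) ≤ P ⊓ LinearMap.ker (D + c • δ) := by
  rintro _ ⟨w, hw, rfl⟩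
  refine ⟨P.add_mem (h.D_mem_succ w hw) (P.smul_mem c (h.δ_mem_succ w hw)), ?_⟩
  simp [h.DD, h.δδ, h.δD]

theorem map_boundaries (c : R) :
    (Pp.map (D + c • δ)).map δ = (P ⊓ LinearMap.ker δ).map D := by
  ext v
  constructor
  · rintro ⟨_, ⟨w, hw, rfl⟩, rfl⟩
    exact ⟨-δ w, ⟨P.neg_mem (h.δ_mem_succ w hw), by simp [h.δδ]⟩, by simp [h.δδ, h.δD]⟩
  · rintro ⟨u, ⟨hu, hu'⟩, rfl⟩
    rw [SetLike.mem_coe, LinearMap.mem_ker] at hu'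
    exact ⟨_, ⟨-e u, Pp.neg_mem (h.e_mem_succ u hu), rfl⟩, by simp [h.δD, h.δe, hu']⟩

theorem boundaries_inf_ker (c : R) :
    Pp.map (D + c • δ) ⊓ LinearMap.ker δ = (Pp ⊓ LinearMap.ker δ).map D ⊔
      (P ⊓ LinearMap.ker δ ⊓ LinearMap.ker D).map (LinearMap.lsmul R E c) := by
  ext v
  constructor
  · rintro ⟨⟨w, hw, rfl⟩, hv⟩
    have hDw : D (δ w) = 0 := by simpa [h.δδ, h.δD] using hv
    refine Submodule.mem_sup.mpr ⟨_, ⟨w - e (δ w), ⟨Pp.sub_mem hw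
      (h.e_mem_succ _ (h.δ_mem_succ w hw)), ?_⟩, rfl⟩, _,
      ⟨δ w, ⟨⟨h.δ_mem_succ w hw, h.δδ w⟩, hDw⟩, rfl⟩, ?_⟩
    · simp [h.δδ, h.δe]
    · simp [h.De, hDw]
  · intro hv
    obtain ⟨_, ⟨u, ⟨hu, hu'⟩, rfl⟩, _, ⟨v, ⟨⟨hvP, hv'⟩, hv''⟩, rfl⟩, rfl⟩ :=
      Submodule.mem_sup.mp hv
    rw [SetLike.mem_coe, LinearMap.mem_ker] at hu' hv' hv''
    refine ⟨⟨u + e v, Pp.add_mem hu (h.e_mem_succ v hvP), ?_⟩, ?_⟩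
    · simp [h.De, h.δe, hu', hv', hv'']
    · simp [h.δD, hu', hv']

omit h in
theorem cycles_inf_ker (c : R) :
    P ⊓ LinearMap.ker (D + c • δ) ⊓ LinearMap.ker δ =
      P ⊓ LinearMap.ker δ ⊓ LinearMap.ker D := by
  ext v
  simp only [Submodule.mem_inf, LinearMap.mem_ker, LinearMap.add_apply, LinearMap.smul_apply]
  constructor
  · rintro ⟨⟨h₁, h₂⟩, h₃⟩
    exact ⟨⟨h₁, h₃⟩, by simpa [h₃] using h₂⟩
  · rintro ⟨⟨h₁, h₂⟩, h₃⟩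
    exact ⟨⟨h₁, by simp [h₂, h₃]⟩, h₂⟩

theorem map_cycles (c : R) :
    (P ⊓ LinearMap.ker (D + c • δ)).map δ = Pm ⊓ LinearMap.ker δ ⊓ LinearMap.ker D ⊓
      ((P ⊓ LinearMap.ker δ).map D).comap (LinearMap.lsmul R E c) := by
  ext v
  constructor
  · rintro ⟨z, ⟨hz, hz'⟩, rfl⟩
    have hDz : D z = -(c • δ z) := eq_neg_of_add_eq_zero_left (by simpa using hz')
    have hDδ : D (δ z) = 0 := by
      rw [← neg_eq_zero, ← h.δD, hDz]
      simp [h.δδ]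
    refine ⟨⟨⟨h.δ_mem z hz, h.δδ z⟩, hDδ⟩, -(z - e (δ z)), ⟨P.neg_mem (P.sub_mem hz
      (h.e_mem _ (h.δ_mem z hz))), ?_⟩, ?_⟩
    · simp [h.δδ, h.δe]
    · simp [h.De, hDδ, hDz]
  · rintro ⟨⟨⟨hv, hv'⟩, hv''⟩, u, ⟨hu, hu'⟩, huv⟩
    rw [SetLike.mem_coe, LinearMap.mem_ker] at hu' hv' hv''
    rw [LinearMap.lsmul_apply] at huv
    refine ⟨e v - u, ⟨P.sub_mem (h.e_mem v hv) hu, ?_⟩, ?_⟩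
    · simp [h.De, h.δe, hu', hv', hv'', huv]
    · simp [h.δe, hu', hv']

theorem map_cycles_inf_comap (c x : R) :
    (P ⊓ LinearMap.ker (D + (c * x) • δ) ⊓
      (Pp.map (D + (c * x) • δ)).comap (LinearMap.lsmul R E c)).map δ =
      (P ⊓ LinearMap.ker (D + c • δ)).map δ := by
  rw [h.map_cycles]
  ext v
  constructor
  · rintro ⟨z, ⟨hz, hcz⟩, rfl⟩
    have hδz : δ z ∈ (P ⊓ LinearMap.ker (D + (c * x) • δ)).map δ := ⟨z, hz, rfl⟩
    rw [h.map_cycles] at hδz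
    refine ⟨hδz.1, ?_⟩
    rw [← h.map_boundaries (c * x)]
    exact ⟨_, hcz, by simp⟩
  · rintro ⟨⟨⟨hv, hv'⟩, hv''⟩, u, ⟨hu, hu'⟩, huv⟩
    rw [SetLike.mem_coe, LinearMap.mem_ker] at hu' hv' hv''
    rw [LinearMap.lsmul_apply] at huv
    refine ⟨e v - x • u, ⟨⟨P.sub_mem (h.e_mem v hv) (P.smul_mem x hu), ?_⟩,
      -e u, Pp.neg_mem (h.e_mem_succ u hu), ?_⟩, ?_⟩
    · simp [h.De, h.δe, hu', hv', hv'', huv, smul_smul, mul_comm]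
    · simp [h.De, h.δe, hu', huv, smul_smul, sub_eq_add_neg]
    · simp [h.δe, hu', hv']

theorem relLength_eq (c x : R)
    (hfin : (P ⊓ LinearMap.ker (D + (c * x) • δ)).relLength (Pp.map (D + (c * x) • δ)) ≠ ⊤) :
    (P ⊓ LinearMap.ker (D + c • δ)).relLength (Pp.map (D + c • δ)) =
      (P ⊓ LinearMap.ker (D + (c * x) • δ) ⊓
        (Pp.map (D + (c * x) • δ)).comap (LinearMap.lsmul R E c)).relLength
          (Pp.map (D + (c * x) • δ)) := by
  have hle := h.boundaries_le_cycles (c * x)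
  rw [Submodule.relLength_eq_add δ (h.boundaries_le_cycles c),
    Submodule.relLength_eq_add δ (le_inf hle fun w hw => Submodule.smul_mem _ c hw),
    h.map_cycles_inf_comap, h.map_boundaries, h.map_boundaries]
  congr 1
  rw [Submodule.relLength_eq_add δ hle] at hfin
  have hW : (P ⊓ LinearMap.ker (D + (c * x) • δ) ⊓
      (Pp.map (D + (c * x) • δ)).comap (LinearMap.lsmul R E c)) ⊓ LinearMap.ker δ =
      (P ⊓ LinearMap.ker (D + (c * x) • δ) ⊓ LinearMap.ker δ) ⊓
        (Pp.map (D + (c * x) • δ) ⊓ LinearMap.ker δ).comap (LinearMap.lsmul R E c) := by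
    ext z
    simp only [Submodule.mem_inf, Submodule.mem_comap, LinearMap.mem_ker, LinearMap.lsmul_apply,
      map_smul]
    constructor
    · rintro ⟨⟨h₁, h₂⟩, h₃⟩
      exact ⟨⟨h₁, h₃⟩, h₂, by rw [h₃, smul_zero]⟩
    · rintro ⟨⟨h₁, h₃⟩, h₂, -⟩
      exact ⟨⟨h₁, h₂⟩, h₃⟩
  rw [hW, ← Submodule.relLength_sup_map_lsmul _ _ c
    (fun h' => hfin (by rw [h', top_add])), cycles_inf_ker, cycles_inf_ker,
    h.boundaries_inf_ker, h.boundaries_inf_ker, sup_assoc]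
  congr 2
  refine (sup_eq_right.mpr ?_).symm
  rintro _ ⟨z, hz, rfl⟩
  exact ⟨x • z, Submodule.smul_mem _ x hz, by simp [smul_smul, mul_comm]⟩

end IsCone

end ConeComplex

theorem Module.length_ne_top_of_le_annihilator
    {R M : Type*} [CommRing R] [IsLocalRing R] [IsNoetherianRing R] [AddCommGroup M] [Module R M]
    [Module.Finite R M] (I : Ideal R) (hI : I.radical = IsLocalRing.maximalIdeal R)
    (hann : I ≤ Module.annihilator R M) : Module.length R M ≠ ⊤ := by
  have hmin : IsLocalRing.maximalIdeal R ∈ I.minimalPrimes := by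
    rw [← Ideal.radical_minimalPrimes, hI, Ideal.minimalPrimes_eq_subsingleton_self]
    rfl
  have := IsLocalRing.quotient_artinian_of_mem_minimalPrimes_of_isLocalRing I hmin
  have htors : Module.IsTorsionBySet R M I := fun m r => Module.mem_annihilator.mp (hann r.2) m
  let : Module (R ⧸ I) M := htors.module
  have : IsScalarTower R (R ⧸ I) M := htors.isScalarTower
  have : Module.Finite (R ⧸ I) M := Module.Finite.of_restrictScalars_finite R _ _
  have : IsArtinian R M :=
    isArtinian_of_surjective_algebraMap (R := R ⧸ I) Ideal.Quotient.mk_surjective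
  exact Module.length_ne_top

section KoszulLength

variable {R : Type*} [CommRing R] {n : ℕ}

theorem ExteriorAlgebra.contractLeft_ι_mul (d : Module.Dual R (Fin n → R)) (v : Fin n → R)
    (w : ExteriorAlgebra R (Fin n → R)) :
    CliffordAlgebra.contractLeft (Q := (0 : QuadraticForm R (Fin n → R))) d
        (ExteriorAlgebra.ι R v * w) =
      d v • w - ExteriorAlgebra.ι R v *
        CliffordAlgebra.contractLeft (Q := (0 : QuadraticForm R (Fin n → R))) d w :=
  CliffordAlgebra.contractLeft_ι_mul d v w

theorem koszulDual_single (a : Fin n → R) (j : Fin n) : koszulDual a (Pi.single j 1) = a j := by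
  simp [koszulDual, Pi.single_apply]

theorem koszulDual_snoc (b : Fin n → R) (c : R) :
    koszulDual (Fin.snoc b c : Fin (n + 1) → R) =
      koszulDual (Fin.snoc b 0 : Fin (n + 1) → R) + c • LinearMap.proj (Fin.last n) := by
  simp [koszulDual, Fin.sum_univ_castSucc]

theorem contractLeft_koszulPiece_zero (d : Module.Dual R (Fin n → R)) :
    ∀ w ∈ koszulPiece R n 0,
      CliffordAlgebra.contractLeft (Q := (0 : QuadraticForm R (Fin n → R))) d w = 0 := by
  intro w hw
  rw [koszulPiece, pow_zero, Submodule.mem_one] at hw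
  obtain ⟨r, rfl⟩ := hw
  exact CliffordAlgebra.contractLeft_algebraMap 0 d r

theorem ι_mul_mem_koszulPiece (v : Fin n → R) {i : ℕ} {w : ExteriorAlgebra R (Fin n → R)}
    (hw : w ∈ koszulPiece R n i) : ExteriorAlgebra.ι R v * w ∈ koszulPiece R n (i + 1) := by
  rw [koszulPiece, pow_succ']
  exact Submodule.mul_mem_mul ⟨v, rfl⟩ hw

theorem contractLeft_mem_koszulPiece (d : Module.Dual R (Fin n → R)) (i : ℕ) :
    ∀ w ∈ koszulPiece R n (i + 1),
      CliffordAlgebra.contractLeft (Q := (0 : QuadraticForm R (Fin n → R))) d w ∈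
        koszulPiece R n i := by
  induction i with
  | zero =>
    intro w hw
    rw [koszulPiece, pow_succ'] at hw
    induction hw using Submodule.mul_induction_on' with
    | mem_mul_mem m hm w hw =>
      obtain ⟨v, rfl⟩ := hm
      rw [ExteriorAlgebra.contractLeft_ι_mul]
      rw [contractLeft_koszulPiece_zero d w hw, mul_zero, sub_zero]
      exact Submodule.smul_mem _ _ hw
    | add x _ y _ hx hy => rw [map_add]; exact Submodule.add_mem _ hx hy
  | succ i ih =>
    intro w hw
    rw [koszulPiece, pow_succ'] at hw
    induction hw using Submodule.mul_induction_on' with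
    | mem_mul_mem m hm w hw =>
      obtain ⟨v, rfl⟩ := hm
      rw [ExteriorAlgebra.contractLeft_ι_mul]
      exact Submodule.sub_mem _ (Submodule.smul_mem _ _ hw) (ι_mul_mem_koszulPiece v (ih w hw))
    | add x _ y _ hx hy => rw [map_add]; exact Submodule.add_mem _ hx hy

theorem koszulDiff_snoc (b : Fin n → R) (c : R) :
    koszulDiff (Fin.snoc b c : Fin (n + 1) → R) =
      koszulDiff (Fin.snoc b 0 : Fin (n + 1) → R) +
        c • CliffordAlgebra.contractLeft (Q := (0 : QuadraticForm R (Fin (n + 1) → R)))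
          (LinearMap.proj (Fin.last n)) := by
  rw [koszulDiff, koszulDual_snoc, map_add, map_smul]
  rfl

theorem exists_isCone_koszul (b : Fin n → R) (i : ℕ) :
    ∃ Pm, IsCone (koszulDiff (Fin.snoc b 0 : Fin (n + 1) → R))
      (CliffordAlgebra.contractLeft (Q := (0 : QuadraticForm R (Fin (n + 1) → R)))
          (LinearMap.proj (Fin.last n)))
      (LinearMap.mulLeft R (ExteriorAlgebra.ι R (Pi.single (Fin.last n) 1)))
      Pm (koszulPiece R (n + 1) i) (koszulPiece R (n + 1) (i + 1)) := by
  suffices ∃ Pm : Submodule R (ExteriorAlgebra R (Fin (n + 1) → R)),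
      (∀ w ∈ koszulPiece R (n + 1) i, CliffordAlgebra.contractLeft
        (Q := (0 : QuadraticForm R (Fin (n + 1) → R))) (LinearMap.proj (Fin.last n)) w ∈ Pm) ∧
      ∀ w ∈ Pm, ExteriorAlgebra.ι R (Pi.single (Fin.last n) 1) * w ∈ koszulPiece R (n + 1) i by
    obtain ⟨Pm, h₁, h₂⟩ := this
    refine ⟨Pm, ?_, ?_, ?_, ?_, ?_, h₁, contractLeft_mem_koszulPiece _ _,
      contractLeft_mem_koszulPiece _ _, h₂, fun w hw => ι_mul_mem_koszulPiece _ hw⟩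
    · exact CliffordAlgebra.contractLeft_contractLeft _
    · exact CliffordAlgebra.contractLeft_contractLeft _
    · exact CliffordAlgebra.contractLeft_comm _ _
    · intro w
      refine (ExteriorAlgebra.contractLeft_ι_mul _ _ _).trans ?_
      simp
    · intro w
      refine (ExteriorAlgebra.contractLeft_ι_mul _ _ _).trans ?_
      rw [koszulDual_single]
      simp
      rfl
  cases i with
  | zero =>
    refine ⟨⊥, fun w hw => contractLeft_koszulPiece_zero _ w hw, fun w hw => ?_⟩
    rw [(Submodule.mem_bot R).mp hw, mul_zero]
    exact Submodule.zero_mem _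
  | succ i =>
    exact ⟨koszulPiece R (n + 1) i, contractLeft_mem_koszulPiece _ _,
      fun w hw => ι_mul_mem_koszulPiece _ hw⟩

theorem span_range_le_annihilator_koszulHomology (a : Fin n → R) (i : ℕ) :
    Ideal.span (Set.range a) ≤ Module.annihilator R (koszulHomology a i) := by
  rw [Ideal.span_le]
  rintro _ ⟨j, rfl⟩
  rw [SetLike.mem_coe, Module.mem_annihilator]
  intro q
  obtain ⟨⟨z, hz, hdz⟩, rfl⟩ := Submodule.mkQ_surjective _ q
  refine (Submodule.Quotient.mk_eq_zero _).mpr ?_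
  refine ⟨ExteriorAlgebra.ι R (Pi.single j 1) * z, ι_mul_mem_koszulPiece _ hz, ?_⟩
  refine (ExteriorAlgebra.contractLeft_ι_mul _ _ _).trans ?_
  rw [koszulDual_single, show CliffordAlgebra.contractLeft (koszulDual a) z = 0 from hdz]
  simp

theorem koszulHomology_finite [IsNoetherianRing R] (a : Fin n → R) (i : ℕ) :
    Module.Finite R (koszulHomology a i) := by
  have : Module.Finite R (koszulPiece R n i) :=
    inferInstanceAs (Module.Finite R (⋀[R]^i (Fin n → R)))
  have : Module.Finite R (koszulCycles a i) :=
    Module.Finite.of_injective (Submodule.inclusion (inf_le_left : _ ≤ koszulPiece R n i))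
      (Submodule.inclusion_injective _)
  exact inferInstanceAs (Module.Finite R
    (koszulCycles a i ⧸ (koszulBoundaries a i).comap (koszulCycles a i).subtype))

end KoszulLength

/-- **Lemma.**  Let `(R, 𝔪)` be a local Noetherian ring, `J ⊆ R` an ideal and
`c, x ∈ R` such that `(J, cx)` is `𝔪`-primary.  Then for every `i`,
`λ(H_i(J, c)) = λ(ann_c H_i(J, cx))`, where the Koszul homologies are taken on a
generating sequence of `J` together with `c` (resp. `cx`), and
`ann_c M = {u ∈ M : c • u = 0}`. -/
theorem length_koszul_eq_length_annBy
    {R : Type*} [CommRing R] [IsLocalRing R] [IsNoetherianRing R]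
    (J : Ideal R) (c x : R)
    (hprimary : (J + Ideal.span {c * x}).radical = IsLocalRing.maximalIdeal R)
    {k : ℕ} (b : Fin k → R) (hb : Ideal.span (Set.range b) = J) (i : ℕ) :
    moduleLength R (koszulHomology (Fin.snoc b c) i) =
      moduleLength R
        (LinearMap.ker (LinearMap.lsmul R (koszulHomology (Fin.snoc b (c * x)) i) c)) := by
  have hfin : Module.length R (koszulHomology (Fin.snoc b (c * x)) i) ≠ ⊤ := by
    have := koszulHomology_finite (Fin.snoc b (c * x) : Fin (k + 1) → R) i
    refine Module.length_ne_top_of_le_annihilator _ hprimary ?_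
    refine le_trans ?_ (span_range_le_annihilator_koszulHomology _ i)
    rw [← hb, Submodule.add_eq_sup, sup_le_iff, Ideal.span_le, Ideal.span_le]
    constructor
    · rintro _ ⟨j, rfl⟩
      exact Ideal.subset_span ⟨j.castSucc, by simp⟩
    · rintro _ rfl
      exact Ideal.subset_span ⟨Fin.last k, by simp⟩
  obtain ⟨Pm, hcone⟩ := exists_isCone_koszul b i
  rw [moduleLength, moduleLength, ← Module.coe_length, ← Module.coe_length, WithBot.coe_inj]
  have hlen := hcone.relLength_eq c x
  rw [← koszulDiff_snoc, ← koszulDiff_snoc] at hlen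
  exact (hlen hfin).trans (Submodule.relLength_inf_comap_lsmul _ _ c)
end

section
/- Let R be a local Noetherian ring with char(R) ≠ 2 and let I be a height three perfect Gorenstein ideal minimally generated by n ≥ 5 elements. Then (Ann(H_1(I)))^2 is contained in the integral closure of I, where H_1(I) is the first Koszul homology module of a minimal generating set of I. -/
universe u

/-- The height of an ideal: the infimum of the heights of the primes containing it. -/
noncomputable def idealHeight {R : Type*} [CommRing R] (I : Ideal R) : ℕ∞ :=
  ⨅ (p : PrimeSpectrum R) (_ : I ≤ p.asIdeal), Order.height p

/-- A local ring is Cohen–Macaulay if some regular sequence in the maximal ideal has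
length equal to the Krull dimension of the ring (i.e. depth = dim). -/
def IsCohenMacaulayLocalRing (R : Type*) [CommRing R] [IsLocalRing R] : Prop :=
  ∃ l : List R, (∀ x ∈ l, x ∈ IsLocalRing.maximalIdeal R) ∧
    RingTheory.Sequence.IsRegular R l ∧ ringKrullDim R = l.length

/-- The ideal `I` has grade `g`: it contains a regular sequence of length `g` but none
of length `g + 1`. -/
def Ideal.HasGrade {R : Type*} [CommRing R] (I : Ideal R) (g : ℕ) : Prop :=
  (∃ l : List R, (∀ x ∈ l, x ∈ I) ∧ RingTheory.Sequence.IsRegular R l ∧ l.length = g) ∧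
    ¬∃ l : List R, (∀ x ∈ l, x ∈ I) ∧ RingTheory.Sequence.IsRegular R l ∧ l.length = g + 1
open CategoryTheory in
/-- `Ext^n_R(M, N)`, via the derived functor `Ext` on `ModuleCat R`. -/
noncomputable def ExtMod (R : Type u) [CommRing R] (M N : Type u)
    [AddCommGroup M] [Module R M] [AddCommGroup N] [Module R N] (n : ℕ) : Type u :=
  ((Ext R (ModuleCat.{u} R) n).obj (Opposite.op (ModuleCat.of R M))).obj (ModuleCat.of R N)

open CategoryTheory in
noncomputable instance (R : Type u) [CommRing R] (M N : Type u)
    [AddCommGroup M] [Module R M] [AddCommGroup N] [Module R N] (n : ℕ) :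
    AddCommGroup (ExtMod R M N n) :=
  inferInstanceAs (AddCommGroup
    (((Ext R (ModuleCat.{u} R) n).obj (Opposite.op (ModuleCat.of R M))).obj (ModuleCat.of R N)))

open CategoryTheory in
noncomputable instance (R : Type u) [CommRing R] (M N : Type u)
    [AddCommGroup M] [Module R M] [AddCommGroup N] [Module R N] (n : ℕ) :
    Module R (ExtMod R M N n) :=
  inferInstanceAs (Module R
    (((Ext R (ModuleCat.{u} R) n).obj (Opposite.op (ModuleCat.of R M))).obj (ModuleCat.of R N)))

/-- `M` has projective dimension at most `n`: `Ext^{n+1}(M, -)` vanishes. -/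
noncomputable def HasProjDimLE (R : Type u) [CommRing R] (M : Type u)
    [AddCommGroup M] [Module R M] (n : ℕ) : Prop :=
  ∀ (N : Type u) [AddCommGroup N] [Module R N], Subsingleton (ExtMod R M N (n + 1))

/-- `M` has projective dimension exactly `n` (in particular, finite). -/
noncomputable def ProjDimEq (R : Type u) [CommRing R] (M : Type u)
    [AddCommGroup M] [Module R M] (n : ℕ) : Prop :=
  HasProjDimLE R M n ∧ ∀ m, HasProjDimLE R M m → n ≤ m

/-- `M` has projective dimension `< n` (with the convention `pd 0 = -∞`). -/
noncomputable def ProjDimLT (R : Type u) [CommRing R] (M : Type u)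
    [AddCommGroup M] [Module R M] (n : ℕ) : Prop :=
  Subsingleton M ∨ ∃ k, n = k + 1 ∧ HasProjDimLE R M k

section GorensteinIdeals

open Matrix

section Core

variable {R : Type*} [CommRing R]

/-- Powers of a sequence `x, y` that is regular in the elementary sense. -/
theorem pow_dvd_of_pow_dvd_pow_mul {x y : R} (hx : ∀ t, x * t = 0 → t = 0)
    (hxy : ∀ t, x ∣ y * t → x ∣ t) (k l : ℕ) (t : R) (h : x ^ k ∣ y ^ l * t) : x ^ k ∣ t := by
  have key : ∀ k t, x ^ k ∣ y * t → x ^ k ∣ t := by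
    intro k
    induction k with
    | zero => intro t _; simp
    | succ k ih =>
      intro t ht
      obtain ⟨s, rfl⟩ := hxy t ((Dvd.intro_left _ (pow_succ x k).symm).trans ht)
      obtain ⟨w, hw⟩ := ht
      have : y * s = x ^ k * w := by
        refine sub_eq_zero.mp (hx _ ?_)
        linear_combination hw
      obtain ⟨v, rfl⟩ := ih s ⟨w, this⟩
      exact ⟨v, by ring⟩
  induction l generalizing t with
  | zero => simpa using h
  | succ l ih => exact ih t (key k _ (by rwa [pow_succ', mul_assoc] at h))

/-- Permuting rows and columns changes a determinant by a factor independent of the matrix. -/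
theorem exists_det_submatrix_equiv_eq {ι κ : Type*} [Fintype ι] [DecidableEq ι] [Fintype κ]
    [DecidableEq κ] (f g : ι ≃ κ) :
    ∃ ε : R, ∀ N : Matrix κ κ R, (N.submatrix f g).det = ε * N.det := by
  refine ⟨((Equiv.Perm.sign (f.symm.trans g) : ℤ) : R), fun N => ?_⟩
  rw [← Matrix.det_permute', ← Matrix.det_submatrix_equiv_self f]
  congr 1
  ext i j
  simp

/-- Jacobi's identity for complementary minors of two matrices with scalar product. -/
theorem det_mul_det_toBlocks₂₂ {α β : Type*} [Fintype α] [DecidableEq α] [Fintype β]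
    [DecidableEq β] (P Q : Matrix (α ⊕ β) (α ⊕ β) R) (X : R) (h : P * Q = X • 1) :
    P.det * Q.toBlocks₂₂.det = P.toBlocks₁₁.det * X ^ Fintype.card β := by
  have h' : P * fromBlocks 1 Q.toBlocks₁₂ 0 Q.toBlocks₂₂ =
      fromBlocks P.toBlocks₁₁ 0 P.toBlocks₂₁ (X • 1) := by
    rw [← fromBlocks_toBlocks P, ← fromBlocks_toBlocks Q, fromBlocks_multiply,
      ← fromBlocks_one, fromBlocks_smul, fromBlocks_inj] at h
    obtain ⟨-, h₁₂, -, h₂₂⟩ := h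
    conv_lhs => rw [← fromBlocks_toBlocks P]
    rw [fromBlocks_multiply]
    simp [h₁₂, h₂₂]
  have := congrArg det h'
  rwa [det_mul, det_fromBlocks_zero₂₁, det_fromBlocks_zero₁₂, det_one, one_mul, det_smul,
    det_one, mul_one] at this

theorem det_mem_pow_card {ι : Type*} [Fintype ι] [DecidableEq ι] {J : Ideal R}
    {N : Matrix ι ι R} (h : ∀ i j, N i j ∈ J) : N.det ∈ J ^ Fintype.card ι := by
  rw [det_apply]
  refine sum_mem fun σ _ => ?_
  rw [Units.smul_def]
  refine zsmul_mem ?_ _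
  have := Ideal.prod_mem_prod (s := Finset.univ) (I := fun _ : ι => J)
    (x := fun i => N (σ i) i) fun i _ => h _ _
  simpa using this

variable {n m r : ℕ}

/-- A free complex `0 → R^r → R^m → R^n → R`, exact except possibly at `R`. -/
structure IsFreeRes (a : Fin n → R) (A : Matrix (Fin n) (Fin m) R)
    (B : Matrix (Fin m) (Fin r) R) : Prop where
  vecMul_eq_zero : a ᵥ* A = 0
  mul_eq_zero : A * B = 0
  exact₁ : ∀ c, a ⬝ᵥ c = 0 → ∃ u, A *ᵥ u = c
  exact₂ : ∀ u, A *ᵥ u = 0 → ∃ t, B *ᵥ t = u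
  injective : ∀ t, B *ᵥ t = 0 → t = 0

namespace IsFreeRes

variable {a : Fin n → R} {A : Matrix (Fin n) (Fin m) R} {B : Matrix (Fin m) (Fin r) R}

/-- The two halves of the folded complex: the differential and a contracting homotopy. -/
abbrev odd (a : Fin n → R) (B : Matrix (Fin m) (Fin r) R) (s₁ : Matrix (Fin m) (Fin n) R) :
    Matrix (Unit ⊕ Fin m) (Fin n ⊕ Fin r) R :=
  fromBlocks (replicateRow Unit a) 0 s₁ B

/-- See `IsFreeRes.odd`. -/
abbrev even (A : Matrix (Fin n) (Fin m) R) (s₀ : Fin n → R) (s₂ : Matrix (Fin r) (Fin m) R) :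
    Matrix (Fin n ⊕ Fin r) (Unit ⊕ Fin m) R :=
  fromBlocks (replicateCol Unit s₀) A 0 s₂

theorem exists_homotopy (h : IsFreeRes a A B) {x : R} (hx : x ∈ Ideal.span (Set.range a)) :
    ∃ (s₀ : Matrix (Fin n) Unit R) (s₁ : Matrix (Fin m) (Fin n) R) (s₂ : Matrix (Fin r) (Fin m) R),
      replicateRow Unit a * s₀ = x • 1 ∧ A * s₁ + s₀ * replicateRow Unit a = x • 1 ∧
      B * s₂ + s₁ * A = x • 1 ∧ s₂ * B = x • 1 := by
  have hlift : ∀ {p : ℕ} (C : Matrix (Fin n) (Fin p) R), replicateRow Unit a * C = 0 →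
      ∃ D : Matrix (Fin m) (Fin p) R, A * D = C := by
    intro p C hC
    have : ∀ j, ∃ u, A *ᵥ u = C.col j := fun j => h.exact₁ _ (by
      simpa [mul_apply, dotProduct] using congrFun (congrFun hC ()) j)
    choose u hu using this
    exact ⟨(Matrix.of u)ᵀ, by ext i j; simpa [mulVec, mul_apply, dotProduct] using congrFun (hu j) i⟩
  have hlift' : ∀ {p : ℕ} (C : Matrix (Fin m) (Fin p) R), A * C = 0 →
      ∃ D : Matrix (Fin r) (Fin p) R, B * D = C := by
    intro p C hC
    have : ∀ j, ∃ u, B *ᵥ u = C.col j := fun j => h.exact₂ _ (by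
      ext i
      simpa [mul_apply, mulVec, dotProduct] using congrFun (congrFun hC i) j)
    choose u hu using this
    exact ⟨(Matrix.of u)ᵀ, by ext i j; simpa [mulVec, mul_apply, dotProduct] using congrFun (hu j) i⟩
  have hinj : ∀ {p : ℕ} (C : Matrix (Fin r) (Fin p) R), B * C = 0 → C = 0 := by
    intro p C hC
    ext i j
    refine congrFun (h.injective (C.col j) ?_) i
    ext k
    simpa [mul_apply, mulVec, dotProduct] using congrFun (congrFun hC k) j
  have haA : replicateRow Unit a * A = 0 := by
    ext i j
    simpa [mul_apply, vecMul, dotProduct] using congrFun h.vecMul_eq_zero j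
  obtain ⟨c, hc⟩ := Ideal.mem_span_range_iff_exists_fun.mp hx
  have h₀ : replicateRow Unit a * replicateCol Unit c = x • (1 : Matrix Unit Unit R) := by
    ext i j
    simp [mul_apply, ← hc, mul_comm]
  obtain ⟨s₁, hs₁⟩ := hlift (x • 1 - replicateCol Unit c * replicateRow Unit a) (by
    rw [Matrix.mul_sub, ← Matrix.mul_assoc, h₀]; simp)
  have hA : A * s₁ * A = x • A := by
    rw [hs₁, Matrix.sub_mul, Matrix.mul_assoc, haA]; simp
  obtain ⟨s₂, hs₂⟩ := hlift' (x • 1 - s₁ * A) (by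
    rw [Matrix.mul_sub, ← Matrix.mul_assoc, hA]; simp)
  refine ⟨replicateCol Unit c, s₁, s₂, h₀, by rw [hs₁]; abel, by rw [hs₂]; abel, ?_⟩
  refine sub_eq_zero.mp (hinj _ ?_)
  rw [Matrix.mul_sub, ← Matrix.mul_assoc, hs₂, Matrix.sub_mul, Matrix.mul_assoc, h.mul_eq_zero]
  simp

theorem exists_odd_mul_even (h : IsFreeRes a A B) {x : R} (hx : x ∈ Ideal.span (Set.range a)) :
    ∃ (s₀ : Fin n → R) (s₁ : Matrix (Fin m) (Fin n) R) (s₂ : Matrix (Fin r) (Fin m) R),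
      odd a B s₁ * even A s₀ s₂ = x ^ 2 • (1 : Matrix (Unit ⊕ Fin m) (Unit ⊕ Fin m) R) ∧
      even A s₀ s₂ * odd a B s₁ = x ^ 2 • (1 : Matrix (Fin n ⊕ Fin r) (Fin n ⊕ Fin r) R) := by
  obtain ⟨s₀, s₁, s₂, h₀, h₁, h₂, h₃⟩ := h.exists_homotopy hx
  have haA : replicateRow Unit a * A = 0 := by
    ext i j
    simpa [mul_apply, vecMul, dotProduct] using congrFun h.vecMul_eq_zero j
  have hAB := h.mul_eq_zero
  have hA : A * s₁ * A = x • A := by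
    rw [eq_sub_of_add_eq h₁, Matrix.sub_mul, Matrix.mul_assoc, haA]; simp
  have hs₁₀ : A * (s₁ * s₀) = 0 := by
    rw [← Matrix.mul_assoc, eq_sub_of_add_eq h₁, Matrix.sub_mul, Matrix.mul_assoc, h₀]; simp
  have hs₂₁ : s₂ * s₁ * A = 0 := by
    rw [Matrix.mul_assoc, eq_sub_of_add_eq' h₂, Matrix.mul_sub, ← Matrix.mul_assoc, h₃]; simp
  have hs₀ : replicateCol Unit (x • s₀.col ()) = x • s₀ := by ext i j; simp
  refine ⟨x • s₀.col (), s₁ * A * s₁, x • s₂, ?_, ?_⟩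
  · rw [odd, even, fromBlocks_multiply, hs₀, ← fromBlocks_one, fromBlocks_smul, fromBlocks_inj]
    refine ⟨?_, ?_, ?_, ?_⟩
    · simp [h₀, smul_smul, sq]
    · simp [haA]
    · simp [Matrix.mul_assoc, hs₁₀]
    · rw [Matrix.mul_assoc, Matrix.mul_assoc, ← Matrix.mul_assoc A, hA, Matrix.mul_smul,
        Matrix.mul_smul, ← smul_add, add_comm, h₂, smul_smul, sq]
  · rw [odd, even, fromBlocks_multiply, hs₀, ← fromBlocks_one, fromBlocks_smul, fromBlocks_inj]
    refine ⟨?_, ?_, ?_, ?_⟩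
    · rw [← Matrix.mul_assoc, ← Matrix.mul_assoc, hA, Matrix.smul_mul, Matrix.smul_mul,
        ← smul_add, add_comm, h₁, smul_smul, sq]
    · simp [hAB]
    · rw [Matrix.smul_mul, ← Matrix.mul_assoc, ← Matrix.mul_assoc, hs₂₁]; simp
    · simp [h₃, smul_smul, sq]

theorem card_eq [Nontrivial R] (h : IsFreeRes a A B) {x : R}
    (hx : x ∈ Ideal.span (Set.range a)) (hreg : ∀ t, x * t = 0 → t = 0) : m + 1 = n + r := by
  obtain ⟨s₀, s₁, s₂, h₁, h₂⟩ := h.exists_odd_mul_even hx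
  have key : ∀ {ι κ : Type} [Fintype ι] [Fintype κ] [DecidableEq ι] (P : Matrix ι κ R)
      (Q : Matrix κ ι R), P * Q = x ^ 2 • 1 → Fintype.card ι ≤ Fintype.card κ := by
    intro ι κ _ _ _ P Q hPQ
    refine card_le_of_injective R Q.mulVecLin ((injective_iff_map_eq_zero _).mpr fun v hv => ?_)
    have : x ^ 2 • v = 0 := by
      rw [← one_mulVec v, ← smul_mulVec, ← hPQ, ← mulVec_mulVec]
      simp only [mulVecLin_apply] at hv
      simp [hv]
    ext i
    refine hreg _ (hreg _ ?_)
    simpa [sq, mul_assoc] using congrFun this i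
  have e₁ := key _ _ h₁
  have e₂ := key _ _ h₂
  simp at e₁ e₂
  omega

/-- Each product `aᵢ Δ`, with `Δ` a maximal minor of `B`, is proportional to the complementary
minor `M` of `A`; the factor depends on the homotopy only. -/
theorem exists_complementary_minor (hcard : m + 1 = n + r) (e : Unit ⊕ Fin m ≃ Fin n ⊕ Fin r)
    {J : Ideal R} (hJ : ∀ i j, A i j ∈ J) (i : Fin n) (f : Fin r → Fin m) :
    ∃ M ∈ J ^ (n - 1), ∀ (X : R) (s₀ : Fin n → R) (s₁ : Matrix (Fin m) (Fin n) R)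
      (s₂ : Matrix (Fin r) (Fin m) R),
      odd a B s₁ * even A s₀ s₂ = X • (1 : Matrix (Unit ⊕ Fin m) (Unit ⊕ Fin m) R) →
      even A s₀ s₂ * odd a B s₁ = X • (1 : Matrix (Fin n ⊕ Fin r) (Fin n ⊕ Fin r) R) →
      X ^ (n - 1) * (a i * (B.submatrix f id).det) = ((odd a B s₁).submatrix id e).det * M := by
  by_cases hf : Function.Injective f
  swap
  · refine ⟨0, zero_mem _, fun X s₀ s₁ s₂ _ _ => ?_⟩
    simp only [Function.Injective, not_forall] at hf
    obtain ⟨j, k, hjk, hne⟩ := hf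
    rw [det_zero_of_row_eq hne (by ext t; simp [hjk])]
    simp
  let β := {j : Fin n // j ≠ i}
  have hβ : Fintype.card β = n - 1 := by simp [β]
  obtain ⟨g⟩ : Nonempty (β ≃ {j : Fin m // j ∉ Set.range f}) := by
    classical
    refine ⟨Fintype.equivOfCardEq ?_⟩
    have : Fintype.card {j : Fin m // j ∈ Set.range f} = r := by
      rw [Set.card_range_of_injective hf, Fintype.card_fin]
    rw [hβ, Fintype.card_subtype_compl, this, Fintype.card_fin]
    have := i.pos
    omega
  let f₁ : (Unit ⊕ Fin r) ⊕ β → Unit ⊕ Fin m :=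
    Sum.elim (Sum.map id f) fun j => Sum.inr (g j).1
  let f₂ : (Unit ⊕ Fin r) ⊕ β → Fin n ⊕ Fin r :=
    Sum.elim (Sum.elim (fun _ => Sum.inl i) Sum.inr) fun j => Sum.inl j.1
  have hf₁ : Function.Bijective f₁ := by
    refine (Fintype.bijective_iff_injective_and_card _).mpr ⟨?_, ?_⟩
    · rintro ((_ | j) | j) ((_ | k) | k) hjk
      all_goals simp [f₁] at hjk
      · rfl
      · rw [hf hjk]
      · exact absurd ⟨j, hjk⟩ (g k).2
      · exact absurd ⟨k, hjk.symm⟩ (g j).2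
      · rw [g.injective (Subtype.ext hjk)]
    · have := i.pos
      simp only [Fintype.card_sum, hβ, Fintype.card_fin, Fintype.card_unit]
      omega
  have hf₂ : Function.Bijective f₂ := by
    refine (Fintype.bijective_iff_injective_and_card _).mpr ⟨?_, ?_⟩
    · rintro ((_ | j) | j) ((_ | k) | k) hjk
      all_goals simp [f₂] at hjk
      · rfl
      · exact absurd hjk.symm k.2
      · rw [hjk]
      · exact absurd hjk j.2
      · rw [Subtype.ext hjk]
    · have := i.pos
      simp only [Fintype.card_sum, hβ, Fintype.card_fin, Fintype.card_unit]
      omega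
  let g₁ := Equiv.ofBijective f₁ hf₁
  let g₂ := Equiv.ofBijective f₂ hf₂
  obtain ⟨ε, hε⟩ := exists_det_submatrix_equiv_eq (R := R) g₁ (g₂.trans e.symm)
  refine ⟨ε * (A.submatrix (fun j : β => j.1) (fun j => (g j).1)).det, ?_, ?_⟩
  · exact Ideal.mul_mem_left _ _ (hβ ▸ det_mem_pow_card fun j k => hJ _ _)
  · intro X s₀ s₁ s₂ h₁ h₂
    have hP : (((odd a B s₁).submatrix id e).submatrix g₁ (g₂.trans e.symm)) =
        (odd a B s₁).submatrix g₁ g₂ := by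
      ext j k
      simp
    have key := det_mul_det_toBlocks₂₂ ((odd a B s₁).submatrix g₁ g₂)
      ((even A s₀ s₂).submatrix g₂ g₁) X (by
        rw [submatrix_mul_equiv, h₁]
        ext j k
        simp [one_apply])
    have h₁₁ : ((odd a B s₁).submatrix g₁ g₂).toBlocks₁₁ =
        fromBlocks (replicateRow Unit fun _ : Unit => a i) 0 (of fun j _ => s₁ (f j) i)
          (B.submatrix f id) := by
      ext (j | j) (k | k) <;> rfl
    have h₂₂ : ((even A s₀ s₂).submatrix g₂ g₁).toBlocks₂₂ =
        A.submatrix (fun j : β => j.1) (fun j => (g j).1) := by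
      ext j k; rfl
    rw [h₁₁, h₂₂, det_fromBlocks_zero₁₂, ← hP, hε, hβ] at key
    simp only [det_unique, replicateRow_apply] at key
    linear_combination -key

/-- If the maximal minors of `B` generate an ideal containing `I`, a Gorenstein-type condition,
then `I ^ 2` lies in the ideal of submaximal minors of `A`. -/
theorem mul_mem_pow [Nontrivial R] (h : IsFreeRes a A B) {J : Ideal R} (hJ : ∀ i j, A i j ∈ J)
    {x y : R} (hx : x ∈ Ideal.span (Set.range a)) (hy : y ∈ Ideal.span (Set.range a))
    (hreg : ∀ t, x * t = 0 → t = 0) (hreg' : ∀ t, x ∣ y * t → x ∣ t)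
    (hB : ∀ z ∈ Ideal.span (Set.range a),
      z ∈ Ideal.span (Set.range fun f : Fin r → Fin m => (B.submatrix f id).det)) :
    Ideal.span (Set.range a) * Ideal.span (Set.range a) ≤ J ^ (n - 1) := by
  have hcard := h.card_eq hx hreg
  let e : Unit ⊕ Fin m ≃ Fin n ⊕ Fin r := Fintype.equivOfCardEq (by simp; omega)
  choose M hMJ hM using exists_complementary_minor (a := a) (B := B) hcard e hJ
  obtain ⟨s₀, s₁, s₂, h₁, h₂⟩ := h.exists_odd_mul_even hx
  obtain ⟨t₀, t₁, t₂, k₁, k₂⟩ := h.exists_odd_mul_even hy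
  have hMx := fun i f => hM i f _ _ _ _ h₁ h₂
  have hMy := fun i f => hM i f _ _ _ _ k₁ k₂
  set δ := ((odd a B s₁).submatrix id e).det
  set δ' := ((odd a B t₁).submatrix id e).det
  simp only [← pow_mul] at hMx hMy
  have hregpow : ∀ k t, x ^ k * t = 0 → t = 0 := by
    intro k
    induction k with
    | zero => intro t ht; simpa using ht
    | succ k ih => intro t ht; exact ih _ (hreg _ (by rw [← mul_assoc, ← pow_succ']; exact ht))
  have hann : ∀ t, (∀ i f, t * M i f = 0) → t = 0 := by
    intro t ht
    have h₃ : ∀ i f, t * (a i * (B.submatrix f id).det) = 0 := fun i f => by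
      refine hregpow (2 * (n - 1)) _ ?_
      linear_combination t * hMx i f + δ * ht i f
    have h₄ : ∀ i, t * a i = 0 := fun i => by
      refine hreg _ ?_
      refine Submodule.span_induction (p := fun z _ => z * (t * a i) = 0) ?_ ?_ ?_ ?_ (hB x hx)
      · rintro _ ⟨f, rfl⟩
        linear_combination h₃ i f
      · simp
      · intro z w _ _ hz hw
        linear_combination hz + hw
      · intro c z _ hz
        rw [smul_eq_mul]
        linear_combination c * hz
    refine hreg t ?_
    refine Submodule.span_induction (p := fun z _ => z * t = 0) ?_ ?_ ?_ ?_ hx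
    · rintro _ ⟨i, rfl⟩
      linear_combination h₄ i
    · simp
    · intro z w _ _ hz hw
      linear_combination hz + hw
    · intro c z _ hz
      rw [smul_eq_mul]
      linear_combination c * hz
  have hδ : x ^ (2 * (n - 1)) * δ' - y ^ (2 * (n - 1)) * δ = 0 := hann _ fun i f => by
    linear_combination y ^ (2 * (n - 1)) * hMx i f - x ^ (2 * (n - 1)) * hMy i f
  obtain ⟨c, hc⟩ := pow_dvd_of_pow_dvd_pow_mul hreg hreg' (2 * (n - 1)) (2 * (n - 1)) δ
    ⟨δ', by linear_combination -hδ⟩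
  have hmem : ∀ i f, a i * (B.submatrix f id).det ∈ J ^ (n - 1) := fun i f => by
    have : a i * (B.submatrix f id).det - c * M i f = 0 := by
      refine hregpow (2 * (n - 1)) _ ?_
      linear_combination hMx i f + M i f * hc
    rw [sub_eq_zero.mp this]
    exact Ideal.mul_mem_left _ _ (hMJ i f)
  refine (Ideal.mul_mono_right hB).trans ?_
  rw [Ideal.span_mul_span', Ideal.span_le]
  rintro _ ⟨_, ⟨i, rfl⟩, _, ⟨f, rfl⟩, rfl⟩
  exact hmem i f

end IsFreeRes
end Core

theorem det_mul_mem_span_minors {R : Type*} [CommRing R] {m r : ℕ} (G : Matrix (Fin r) (Fin m) R)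
    (B : Matrix (Fin m) (Fin r) R) :
    (G * B).det ∈ Ideal.span (Set.range fun f : Fin r → Fin m => (B.submatrix f id).det) := by
  have h : G * B = fun j => ∑ k, G j k • B k := by
    ext i j
    simp [mul_apply, Finset.sum_apply]
  have h' : (G * B).det = ∑ f : Fin r → Fin m, detRowAlternating fun j => G j (f j) • B (f j) := by
    rw [h]
    exact (detRowAlternating (R := R) (n := Fin r)).toMultilinearMap.map_sum
      fun j k => G j k • B k
  rw [h']
  refine sum_mem fun f _ => ?_
  rw [show (detRowAlternating fun j => G j (f j) • B (f j)) =
      (∏ j, G j (f j)) • detRowAlternating fun j => B (f j) from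
    (detRowAlternating (R := R) (n := Fin r)).toMultilinearMap.map_smul_univ _ _]
  exact Submodule.smul_mem _ _ (Ideal.subset_span ⟨f, rfl⟩)

/-- If the cokernel of `Bᵀ` is isomorphic to `R ⧸ I`, then `I` is contained in the ideal of
maximal minors of `B`. -/
theorem mem_span_minors_of_cokernel {R : Type*} [CommRing R] [IsLocalRing R] {m r : ℕ}
    {I : Ideal R} (hI : I ≠ ⊤) (B : Matrix (Fin m) (Fin r) R) (π : (Fin r → R) →ₗ[R] R ⧸ I)
    (hπ : Function.Surjective π) (hker : ∀ v, π v = 0 → ∃ u, u ᵥ* B = v) {y : R} (hy : y ∈ I) :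
    y ∈ Ideal.span (Set.range fun f : Fin r → Fin m => (B.submatrix f id).det) := by
  choose c hc using fun j => Ideal.Quotient.mk_surjective (π (Pi.single j 1))
  obtain ⟨j₀, hj₀⟩ : ∃ j, IsUnit (c j) := by
    by_contra! hcon
    obtain ⟨w, hw⟩ := hπ 1
    have h₁ : ∑ j, w j * c j - 1 ∈ I := by
      rw [← Ideal.Quotient.mk_eq_mk_iff_sub_mem, map_one, ← hw, map_sum]
      conv_rhs => rw [pi_eq_sum_univ' w, map_sum]
      refine Finset.sum_congr rfl fun j _ => ?_
      rw [map_mul, hc, map_smul, Algebra.smul_def]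
      rfl
    have h₂ : ∑ j, w j * c j ∈ IsLocalRing.maximalIdeal R :=
      sum_mem fun j _ => Ideal.mul_mem_left _ _ (hcon j)
    have h₃ := sub_mem h₂ (IsLocalRing.le_maximalIdeal hI h₁)
    rw [sub_sub_cancel] at h₃
    exact (IsLocalRing.maximalIdeal.isMaximal R).ne_top ((Ideal.eq_top_iff_one _).mpr h₃)
  obtain ⟨d, hd⟩ := hj₀.exists_left_inv
  have hcols : ∀ j, π (Function.update (Pi.single j 1) j₀ (if j = j₀ then y else - (c j * d))) = 0 := by
    intro j
    by_cases hj : j = j₀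
    · subst hj
      have : (Function.update (Pi.single j 1) j (if j = j then y else - (c j * d)) : Fin r → R) =
          y • Pi.single j 1 := by
        ext k
        by_cases hk : k = j
        · subst hk; simp
        · simp [hk]
      rw [this, map_smul, ← hc, Algebra.smul_def]
      change Ideal.Quotient.mk I y * _ = 0
      rw [Ideal.Quotient.eq_zero_iff_mem.mpr hy, zero_mul]
    · have : (Function.update (Pi.single j 1) j₀ (if j = j₀ then y else - (c j * d)) : Fin r → R) =
          Pi.single j 1 - (c j * d) • Pi.single j₀ 1 := by
        ext k
        by_cases hk : k = j₀
        · subst hk; simp [hj, Ne.symm hj]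
        · simp [hk]
      rw [this, map_sub, map_smul, ← hc, ← hc, Algebra.smul_def]
      change _ - Ideal.Quotient.mk I (c j * d) * _ = 0
      rw [← map_mul, mul_assoc, hd, mul_one, sub_self]
  choose G hG using fun j => hker _ (hcols j)
  have hmul : Matrix.of G * B =
      (1 : Matrix (Fin r) (Fin r) R).updateCol j₀ (fun j => if j = j₀ then y else - (c j * d)) := by
    ext j k
    have := congrFun (hG j) k
    simp only [vecMul, dotProduct] at this
    rw [mul_apply]
    simp only [of_apply]
    rw [this, Function.update_apply, updateCol_apply]
    simp [one_apply, Pi.single_apply, eq_comm]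
  have hdet : (Matrix.of G * B).det = y := by
    rw [hmul, ← cramer_apply, cramer_one]
    simp
  rw [← hdet]
  exact det_mul_mem_span_minors _ _

section Koszul

variable {R : Type*} [CommRing R] {n : ℕ}

theorem koszulDual_apply (a c : Fin n → R) : koszulDual a c = a ⬝ᵥ c := by
  simp [koszulDual, dotProduct]

theorem koszulBoundaries_one_le (a : Fin n → R) :
    koszulBoundaries a 1 ≤ Submodule.map (ExteriorAlgebra.ι R)
      (Submodule.pi Set.univ fun _ => Ideal.span (Set.range a)) := by
  have hmem : ∀ u : Fin n → R, koszulDual a u ∈ Ideal.span (Set.range a) := fun u => by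
    rw [koszulDual_apply]
    exact sum_mem fun i _ => Ideal.mul_mem_right _ _ (Ideal.subset_span ⟨i, rfl⟩)
  rw [koszulBoundaries, koszulPiece, pow_two, Submodule.map_le_iff_le_comap, Submodule.mul_le]
  rintro _ ⟨u, rfl⟩ _ ⟨v, rfl⟩
  refine ⟨koszulDual a u • v - koszulDual a v • u, ?_, ?_⟩
  · intro i _
    exact sub_mem (Ideal.mul_mem_right _ _ (hmem u)) (Ideal.mul_mem_right _ _ (hmem v))
  · rw [koszulDiff]
    erw [CliffordAlgebra.contractLeft_ι_mul, CliffordAlgebra.contractLeft_ι]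
    rw [map_sub, map_smul, map_smul, ← Algebra.commutes, ← Algebra.smul_def]

theorem mul_mem_of_mem_koszulAnn {a : Fin n → R} {x : R} (hx : x ∈ koszulAnn a 1) {c : Fin n → R}
    (hc : a ⬝ᵥ c = 0) (i : Fin n) : x * c i ∈ Ideal.span (Set.range a) := by
  have hcyc : ExteriorAlgebra.ι R c ∈ koszulCycles a 1 := by
    refine ⟨by simp [koszulPiece], ?_⟩
    change koszulDiff a _ = 0
    rw [koszulDiff]
    erw [CliffordAlgebra.contractLeft_ι]
    rw [koszulDual_apply, hc, map_zero]
  have h := Module.mem_annihilator.mp hx (Submodule.Quotient.mk (p := (koszulBoundaries a 1).comap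
    (koszulCycles a 1).subtype) ⟨_, hcyc⟩)
  have h' : x • (⟨_, hcyc⟩ : koszulCycles a 1) ∈
      (koszulBoundaries a 1).comap (koszulCycles a 1).subtype :=
    (Submodule.Quotient.mk_eq_zero _).mp h
  obtain ⟨v, hv, hvx⟩ := koszulBoundaries_one_le a h'
  have : v = x • c := by
    apply (ExteriorAlgebra.ι_leftInverse (R := R)).injective
    rw [hvx, map_smul, map_smul]
    rfl
  subst this
  exact hv i trivial

end Koszul

section Integral

variable {R : Type*} [CommRing R] [IsNoetherianRing R] [Nontrivial R]

/-- The determinant trick for `z ^ 2` acting on `I ^ 2`. -/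
theorem Ideal.isIntegralElem'_of_sq_mul_mem {I : Ideal R} {x z : R} (hx : x ∈ I)
    (hreg : ∀ t, x * t = 0 → t = 0) (hz : ∀ w ∈ I ^ 2, z ^ 2 * w ∈ I ^ 2 * I ^ 2) :
    I.IsIntegralElem' z := by
  let f : Module.End R ↥(I ^ 2) := z ^ 2 • LinearMap.id
  have hf : LinearMap.range f ≤ (I ^ 2) • ⊤ := by
    rintro _ ⟨w, rfl⟩
    have h := hz w w.2
    have h' : ((f w : ↥(I ^ 2)) : R) ∈
        Submodule.map (I ^ 2).subtype ((I ^ 2) • (⊤ : Submodule R ↥(I ^ 2))) := by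
      rw [Submodule.map_smul'', Submodule.map_top, Submodule.range_subtype]
      exact h
    obtain ⟨w', hw', e⟩ := h'
    rwa [← Subtype.ext e]
  obtain ⟨p, hp, hpd, hcoeff, hpf⟩ :=
    LinearMap.exists_monic_and_natDegree_eq_and_coeff_mem_pow_and_aeval_eq_zero R f (I ^ 2) hf
  have hpz : p.eval (z ^ 2) = 0 := by
    have h₁ : Polynomial.aeval f p = p.eval (z ^ 2) • LinearMap.id := by
      rw [show f = algebraMap R (Module.End R ↥(I ^ 2)) (z ^ 2) from rfl,
        Polynomial.aeval_algebraMap_apply, Polynomial.coe_aeval_eq_eval]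
      rfl
    have h₂ := congrArg (fun g => ((g ⟨x ^ 2, Ideal.pow_mem_pow hx 2⟩ : ↥(I ^ 2)) : R)) (h₁.symm.trans hpf)
    simp at h₂
    refine hreg _ (hreg _ ?_)
    linear_combination h₂
  have hd : 0 < p.natDegree := by
    rw [pos_iff_ne_zero]
    intro h
    rw [hp.natDegree_eq_zero.mp h] at hpz
    simp at hpz
  set d := p.natDegree with hdef
  refine ⟨2 * d, by omega, fun j => if Even j then p.coeff (d - j / 2) else 0, ?_, ?_⟩
  · intro j _ hjd
    dsimp only
    split_ifs with hj
    · have := hcoeff (d - j / 2)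
      obtain ⟨k, rfl⟩ := hj
      rwa [← pow_mul, show 2 * (d - (d - (k + k) / 2)) = k + k by omega] at this
    · exact zero_mem _
  · rw [Polynomial.eval_eq_sum_range, Finset.sum_range_succ, ← hdef, hp.coeff_natDegree, one_mul,
      add_comm, ← pow_mul] at hpz
    refine Eq.trans ?_ hpz
    congr 1
    symm
    refine Finset.sum_of_injOn (fun k => 2 * (d - k)) ?_ ?_ ?_ ?_
    · intro k hk l hl hkl
      simp at hk hl hkl
      omega
    · intro k hk
      simp at hk ⊢
      omega
    · intro j hj hj'
      dsimp only
      rw [if_neg, zero_mul]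
      rintro ⟨k, rfl⟩
      simp at hj
      exact hj' ⟨d - k, by simp; omega, by dsimp only; omega⟩
    · intro k hk
      simp at hk
      dsimp only
      rw [if_pos (even_two_mul _), ← pow_mul]
      congr 2 <;> omega
end Integral

section Homological

open CategoryTheory

variable {R : Type u} [CommRing R]

theorem hasProjectiveDimensionLT_of_hasProjDimLE {M : Type u} [AddCommGroup M] [Module R M] {n : ℕ}
    (h : HasProjDimLE R M n) : HasProjectiveDimensionLT (ModuleCat.of R M) (n + 1) := by
  refine hasProjectiveDimensionLT_of_enoughInjectives _ _ fun Y => ?_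
  let P := projectiveResolution (ModuleCat.of R M)
  refine subsingleton_of_forall_eq 0 fun α => ?_
  obtain ⟨f, hf, rfl⟩ := P.extMk_surjective α (n + 2) rfl
  rw [P.extMk_eq_zero_iff f _ _ _ n rfl]
  have hsub : Subsingleton ((P.complex.linearYonedaObj R Y).homology (n + 1)) :=
    (P.isoExt (R := R) (n + 1) Y).toLinearEquiv.symm.toEquiv.subsingleton_congr.mpr (h Y)
  have hex := (HomologicalComplex.exactAt_iff_isZero_homology _ _).mpr
    (ModuleCat.isZero_of_subsingleton ((P.complex.linearYonedaObj R Y).homology (n + 1)))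
  rw [HomologicalComplex.exactAt_iff' _ n (n + 1) (n + 2) (by simp) (by simp),
    ShortComplex.moduleCat_exact_iff] at hex
  obtain ⟨g, hg⟩ := hex f hf
  exact ⟨g, hg⟩

/-- `Ext` in degree `n` as a cokernel when the next term of the resolution vanishes. -/
theorem exists_surjective_extMod {M N : Type u} [AddCommGroup M] [Module R M] [AddCommGroup N]
    [Module R N] (P : ProjectiveResolution (ModuleCat.of R M)) (n : ℕ)
    (hP : Limits.IsZero (P.complex.X (n + 2))) :
    ∃ π : (P.complex.X (n + 1) ⟶ ModuleCat.of R N) →ₗ[R] ExtMod R M N (n + 1),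
      Function.Surjective π ∧
      ∀ f, π f = 0 → ∃ g : P.complex.X n ⟶ ModuleCat.of R N, P.complex.d (n + 1) n ≫ g = f := by
  let K := P.complex.linearYonedaObj R (ModuleCat.of R N)
  have hd : K.d (n + 1) (n + 2) = 0 := by
    ext f
    exact hP.eq_of_src _ _
  have hc := K.opcyclesIsCokernel n (n + 1) (by simp)
  have hex : (ShortComplex.mk _ _ (K.d_pOpcycles n (n + 1))).Exact :=
    ShortComplex.exact_of_g_is_cokernel _ hc
  let e : K.opcycles (n + 1) ≅
      ((Ext R (ModuleCat.{u} R) (n + 1)).obj (Opposite.op (ModuleCat.of R M))).obj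
        (ModuleCat.of R N) :=
    (K.isoHomologyι (n + 1) (n + 2) (by simp) hd).symm ≪≫
      (P.isoExt (R := R) (n + 1) (ModuleCat.of R N)).symm
  refine ⟨e.toLinearEquiv.toLinearMap ∘ₗ (K.pOpcycles (n + 1)).hom, ?_, ?_⟩
  · exact e.toLinearEquiv.surjective.comp
      ((ModuleCat.epi_iff_surjective (K.pOpcycles (n + 1))).mp inferInstance)
  · intro f hf
    have hf' : (K.pOpcycles (n + 1)).hom f = 0 := e.toLinearEquiv.map_eq_zero_iff.mp hf
    obtain ⟨g, hg⟩ := (ShortComplex.moduleCat_exact_iff _).mp hex f hf'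
    exact ⟨g, hg⟩

section

variable {M : Type u} [AddCommGroup M] [Module R M]
  (X : ℕ → Type u) [∀ n, AddCommGroup (X n)] [∀ n, Module R (X n)]
  (d : ∀ n, X (n + 1) →ₗ[R] X n) (hd : ∀ n, Function.Exact (d (n + 1)) (d n))

/-- The chain complex given by a long exact sequence of linear maps. -/
noncomputable def chainComplexOfExact : ChainComplex (ModuleCat.{u} R) ℕ :=
  ChainComplex.of (fun n => ModuleCat.of R (X n)) (fun n => ModuleCat.ofHom (d n)) fun n => by
    rw [← ModuleCat.ofHom_comp, (hd n).linearMap_comp_eq_zero]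
    rfl

theorem chainComplexOfExact_d (n : ℕ) :
    (chainComplexOfExact X d hd).d (n + 1) n = ModuleCat.ofHom (d n) :=
  ChainComplex.of_d (fun n => ModuleCat.of R (X n)) (fun n => ModuleCat.ofHom (d n)) n

/-- A projective resolution from a long exact sequence of linear maps. -/
noncomputable def projectiveResolutionOfExact [∀ n, Module.Projective R (X n)] (ε : X 0 →ₗ[R] M)
    (hε : Function.Surjective ε) (hd₀ : Function.Exact (d 0) ε) :
    ProjectiveResolution (ModuleCat.of R M) where
  complex := chainComplexOfExact X d hd
  projective n := (IsProjective.iff_projective (R := R) (X n)).mp inferInstance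
  π := (ChainComplex.toSingle₀Equiv _ _).symm ⟨ModuleCat.ofHom ε, by
    rw [chainComplexOfExact_d]
    ext x
    exact hd₀.apply_apply_eq_zero x⟩
  quasiIso := ⟨fun n => by
    cases n with
    | zero =>
      have hπ := ChainComplex.toSingle₀Equiv_symm_apply_f_zero (C := chainComplexOfExact X d hd)
        (X := ModuleCat.of R M) (ModuleCat.ofHom ε) (by
          rw [chainComplexOfExact_d]
          ext x
          exact hd₀.apply_apply_eq_zero x)
      rw [ChainComplex.quasiIsoAt₀_iff, ShortComplex.quasiIso_iff_of_zeros']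
      · refine ⟨?_, ?_⟩
        · rw [ShortComplex.moduleCat_exact_iff]
          intro x hx
          have hx' : ε x = 0 := (congrArg (fun φ => φ.hom x) hπ).symm.trans hx
          change ∃ y, (chainComplexOfExact X d hd).d 1 0 y = x
          rw [chainComplexOfExact_d]
          exact (hd₀ x).mp hx'
        · rw [ModuleCat.epi_iff_surjective]
          intro y
          obtain ⟨x, hx⟩ := hε y
          exact ⟨x, (congrArg (fun φ => φ.hom x) hπ).trans hx⟩
      all_goals rfl
    | succ n =>
      rw [quasiIsoAt_iff_exactAt' _ _ (ChainComplex.exactAt_succ_single_obj _ _),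
        HomologicalComplex.exactAt_iff' _ (n + 2) (n + 1) n (by simp) (by simp),
        ShortComplex.moduleCat_exact_iff]
      intro x hx
      change (chainComplexOfExact X d hd).d (n + 1) n x = 0 at hx
      change ∃ y, (chainComplexOfExact X d hd).d (n + 2) (n + 1) y = x
      rw [chainComplexOfExact_d] at hx ⊢
      exact (hd n x).mp hx⟩

end

namespace IsFreeRes

/-- The ranks of the terms of the resolution attached to `IsFreeRes`. -/
def rank (n m r : ℕ) : ℕ → ℕ
  | 0 => 1
  | 1 => n
  | 2 => m
  | 3 => r
  | _ + 4 => 0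

variable {n m r : ℕ} {a : Fin n → R} {A : Matrix (Fin n) (Fin m) R} {B : Matrix (Fin m) (Fin r) R}

/-- The differentials of the resolution attached to `IsFreeRes`. -/
noncomputable def diff (a : Fin n → R) (A : Matrix (Fin n) (Fin m) R)
    (B : Matrix (Fin m) (Fin r) R) :
    ∀ i, (Fin (rank n m r (i + 1)) → R) →ₗ[R] (Fin (rank n m r i) → R)
  | 0 => (replicateRow (Fin 1) a).mulVecLin
  | 1 => A.mulVecLin
  | 2 => B.mulVecLin
  | _ + 3 => 0

theorem exact_diff (h : IsFreeRes a A B) (i : ℕ) :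
    Function.Exact (diff a A B (i + 1)) (diff a A B i) := by
  have h₁ (u : Fin m → R) : a ⬝ᵥ (A *ᵥ u) = 0 := by
    rw [dotProduct_mulVec, h.vecMul_eq_zero, zero_dotProduct]
  have h₂ (u : Fin r → R) : A *ᵥ (B *ᵥ u) = 0 := by
    rw [mulVec_mulVec, h.mul_eq_zero, zero_mulVec]
  intro x
  match i with
  | 0 =>
    refine ⟨fun hx => h.exact₁ x (congrFun hx (0 : Fin 1)), ?_⟩
    rintro ⟨u, rfl⟩
    exact funext fun _ => h₁ u
  | 1 =>
    refine ⟨fun hx => h.exact₂ x hx, ?_⟩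
    rintro ⟨u, rfl⟩
    exact h₂ u
  | 2 =>
    refine ⟨fun hx => ⟨0, (h.injective x hx).symm⟩, ?_⟩
    rintro ⟨u, rfl⟩
    exact mulVec_zero B
  | i + 3 => exact ⟨fun _ => ⟨0, Subsingleton.elim (α := Fin 0 → R) _ _⟩, fun _ => rfl⟩

theorem exact_replicateRow (a : Fin n → R) :
    Function.Exact (replicateRow (Fin 1) a).mulVecLin
      ((Ideal.span (Set.range a)).mkQ ∘ₗ LinearMap.proj (0 : Fin 1)) := by
  intro x
  rw [LinearMap.comp_apply, Submodule.mkQ_apply, Submodule.Quotient.mk_eq_zero,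
    LinearMap.proj_apply, Ideal.mem_span_range_iff_exists_fun]
  refine exists_congr fun c => ?_
  rw [funext_iff, Fin.forall_fin_one]
  simp [mulVec, dotProduct, mul_comm]

/-- The projective resolution of `R ⧸ (a)` attached to `IsFreeRes`. -/
noncomputable def projectiveResolution (h : IsFreeRes a A B) :
    ProjectiveResolution (ModuleCat.of R (R ⧸ Ideal.span (Set.range a))) :=
  projectiveResolutionOfExact (fun i => Fin (rank n m r i) → R) (diff a A B) h.exact_diff
    ((Ideal.span (Set.range a)).mkQ ∘ₗ LinearMap.proj (0 : Fin 1))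
    ((Submodule.mkQ_surjective _).comp fun x => ⟨fun _ => x, rfl⟩)
    (exact_replicateRow a)

theorem exists_surjective_extMod (h : IsFreeRes a A B) :
    ∃ π : (Fin r → R) →ₗ[R] ExtMod R (R ⧸ Ideal.span (Set.range a)) R 3,
      Function.Surjective π ∧ ∀ v, π v = 0 → ∃ u, u ᵥ* B = v := by
  obtain ⟨π, hπ, hker⟩ := _root_.exists_surjective_extMod (N := R) h.projectiveResolution 2
    (ModuleCat.isZero_of_iff_subsingleton.mpr (inferInstanceAs (Subsingleton (Fin 0 → R))))
  let e : (Fin r → R) ≃ₗ[R] (h.projectiveResolution.complex.X 3 ⟶ ModuleCat.of R R) :=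
    dotProductEquiv R (Fin r) ≪≫ₗ
      (ModuleCat.homLinearEquiv (M := ModuleCat.of R (Fin r → R)) (N := ModuleCat.of R R)
        (S := R)).symm
  refine ⟨π ∘ₗ e.toLinearMap, hπ.comp e.surjective, fun v hv => ?_⟩
  obtain ⟨g, hg⟩ := hker _ hv
  have hd : h.projectiveResolution.complex.d 3 2 = ModuleCat.ofHom (diff a A B 2) :=
    chainComplexOfExact_d (fun i => Fin (rank n m r i) → R) (diff a A B) h.exact_diff 2
  rw [hd] at hg
  let g' : (Fin m → R) →ₗ[R] R := g.hom
  have hg' : ∀ t, g' (B *ᵥ t) = v ⬝ᵥ t := fun t => congrArg (fun φ => φ.hom t) hg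
  obtain ⟨u, hu⟩ := (dotProductEquiv R (Fin m)).surjective g'
  refine ⟨u, dotProduct_eq _ _ fun t => ?_⟩
  rw [← hg', ← hu, ← dotProduct_mulVec]
  rfl

end IsFreeRes

theorem hasProjectiveDimensionLT_ker {P N : Type u} [AddCommGroup P] [Module R P]
    [Module.Projective R P] [AddCommGroup N] [Module R N] (f : P →ₗ[R] N)
    (hf : Function.Surjective f) (n : ℕ)
    (h : HasProjectiveDimensionLT (ModuleCat.of R N) (n + 2)) :
    HasProjectiveDimensionLT (ModuleCat.of R (LinearMap.ker f)) (n + 1) :=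
  ((LinearMap.shortExact_shortComplexKer hf).hasProjectiveDimensionLT_X₃_iff n
    ((IsProjective.iff_projective (R := R) P).mp inferInstance)).mp h

theorem exists_isFreeRes [IsLocalRing R] [IsNoetherianRing R] {n : ℕ} (a : Fin n → R)
    (h : HasProjectiveDimensionLT (ModuleCat.of R (R ⧸ Ideal.span (Set.range a))) 4) :
    ∃ (m r : ℕ) (A : Matrix (Fin n) (Fin m) R) (B : Matrix (Fin m) (Fin r) R),
      IsFreeRes a A B := by
  set I := Ideal.span (Set.range a)
  have hI (c : Fin n → R) : a ⬝ᵥ c ∈ LinearMap.ker I.mkQ := by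
    rw [Submodule.ker_mkQ]
    exact Submodule.sum_mem _ fun i _ => I.mul_mem_right _ (Ideal.subset_span ⟨i, rfl⟩)
  let f₁ : (Fin n → R) →ₗ[R] LinearMap.ker I.mkQ :=
    (dotProductEquiv R (Fin n) a).codRestrict _ hI
  have hf₁ : Function.Surjective f₁ := by
    rintro ⟨x, hx⟩
    rw [Submodule.ker_mkQ, Ideal.mem_span_range_iff_exists_fun] at hx
    obtain ⟨c, hc⟩ := hx
    exact ⟨c, Subtype.ext ((dotProduct_comm a c).trans hc)⟩
  have mem_ker (c : Fin n → R) : c ∈ LinearMap.ker f₁ ↔ a ⬝ᵥ c = 0 := by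
    rw [LinearMap.mem_ker, Subtype.ext_iff]
    rfl
  obtain ⟨m, f₂, hf₂⟩ := Module.Finite.exists_fin' R (LinearMap.ker f₁)
  have hpd := hasProjectiveDimensionLT_ker f₂ hf₂ 0 <| hasProjectiveDimensionLT_ker f₁ hf₁ 1 <|
    hasProjectiveDimensionLT_ker I.mkQ I.mkQ_surjective 2 h
  have : Module.Projective R (LinearMap.ker f₂) :=
    (IsProjective.iff_projective _).mpr (projective_iff_hasProjectiveDimensionLT_one.mpr hpd)
  have : Module.Free R (LinearMap.ker f₂) := Module.free_of_flat_of_isLocalRing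
  let e := (Module.finBasis R (LinearMap.ker f₂)).equivFun
  let A := LinearMap.toMatrix' ((LinearMap.ker f₁).subtype ∘ₗ f₂)
  let B := LinearMap.toMatrix' ((LinearMap.ker f₂).subtype ∘ₗ e.symm.toLinearMap)
  have hA (u) : A *ᵥ u = f₂ u := LinearMap.toMatrix'_mulVec _ _
  have hB (t) : B *ᵥ t = e.symm t := LinearMap.toMatrix'_mulVec _ _
  refine ⟨m, _, A, B, dotProduct_eq _ _ fun u => ?_, ?_, fun c hc => ?_, fun u hu => ?_,
    fun t ht => ?_⟩
  · rw [← dotProduct_mulVec, hA, zero_dotProduct]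
    exact (mem_ker _).mp (f₂ u).2
  · refine Matrix.toLin'.injective (LinearMap.ext fun t => ?_)
    rw [toLin'_apply, ← mulVec_mulVec, hB, hA, LinearMap.mem_ker.mp (e.symm t).2]
    simp
  · obtain ⟨u, hu⟩ := hf₂ ⟨c, (mem_ker c).mpr hc⟩
    exact ⟨u, by rw [hA, hu]⟩
  · rw [hA, ZeroMemClass.coe_eq_zero] at hu
    exact ⟨e ⟨u, hu⟩, by rw [hB, e.symm_apply_apply]⟩
  · rwa [hB, ZeroMemClass.coe_eq_zero, e.symm.map_eq_zero_iff] at ht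

end Homological

section Regular

variable {R : Type*} [CommRing R]

theorem Ideal.HasGrade.exists_regular_pair {I : Ideal R} {g : ℕ} (h : I.HasGrade (g + 2)) :
    ∃ x ∈ I, ∃ y ∈ I, (∀ t, x * t = 0 → t = 0) ∧ ∀ t, x ∣ y * t → x ∣ t := by
  obtain ⟨⟨l, hl, hreg, hlen⟩, -⟩ := h
  match l with
  | [] => simp at hlen
  | [_] => simp at hlen
  | x :: y :: l =>
    obtain ⟨hx, hreg'⟩ := (RingTheory.Sequence.isRegular_cons_iff R x _).mp hreg
    obtain ⟨hy, -⟩ := (RingTheory.Sequence.isRegular_cons_iff _ y _).mp hreg'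
    have key (t : R) : (Submodule.Quotient.mk t : QuotSMulTop x R) = 0 ↔ x ∣ t := by
      rw [Submodule.Quotient.mk_eq_zero, Submodule.mem_smul_pointwise_iff_exists]
      simp [dvd_def, eq_comm]
    refine ⟨x, hl x (by simp), y, hl y (by simp), fun t ht => hx (by simpa using ht),
      fun t ht => (key t).mp (hy ?_)⟩
    exact ((key (y * t)).mpr ht).trans (smul_zero y).symm

theorem Ideal.ne_top_of_one_lt_mu {I : Ideal R} (h : 1 < I.mu) : I ≠ ⊤ := by
  rintro rfl
  refine h.not_ge (Nat.sInf_le ⟨fun _ : Fin 1 => 1, ?_⟩)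
  rw [Set.range_const, Ideal.span_singleton_one]

end Regular

end GorensteinIdeals

/-- **Theorem.**  Let `R` be a local Noetherian ring with `char R ≠ 2` and let `I` be a
height three perfect Gorenstein ideal (grade `3`, `pd_R (R/I) = 3`, and
`Ext³_R(R/I, R) ≅ R/I`) minimally generated by `n ≥ 5` elements.  Then
`(Ann H₁(I))² ⊆ ī`, the integral closure of `I`. -/
theorem sq_ann_first_koszul_le_intClosure_of_gorenstein
    {R : Type u} [CommRing R] [IsLocalRing R] [IsNoetherianRing R]
    (hchar : ringChar R ≠ 2)
    (I : Ideal R) (hht : idealHeight I = 3)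
    (hgrade : I.HasGrade 3) (hpd : ProjDimEq R (R ⧸ I) 3)
    (hGor : Nonempty (ExtMod R (R ⧸ I) R 3 ≃ₗ[R] R ⧸ I))
    (hmu : 5 ≤ I.mu)
    {k : ℕ} (a : Fin k → R) (ha : IsMinGen a I) :
    ∀ x ∈ koszulAnn a 1 ^ 2, I.IsIntegralElem' x := by
  obtain ⟨rfl, hk⟩ := ha
  set I := Ideal.span (Set.range a)
  obtain ⟨x, hx, y, hy, hreg, hreg'⟩ := hgrade.exists_regular_pair
  obtain ⟨m, r, A, B, h⟩ := exists_isFreeRes a (hasProjectiveDimensionLT_of_hasProjDimLE hpd.1)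
  obtain ⟨π, hπ, hker⟩ := h.exists_surjective_extMod
  obtain ⟨e⟩ := hGor
  let J := Ideal.span (Set.range fun p : Fin _ × Fin m => A p.1 p.2)
  have hJ : I * I ≤ J ^ 4 := by
    refine (h.mul_mem_pow (J := J) (fun i j => Ideal.subset_span ⟨(i, j), rfl⟩) hx hy hreg hreg'
      fun z hz => ?_).trans (Ideal.pow_le_pow_right (by lia))
    exact mem_span_minors_of_cokernel (Ideal.ne_top_of_one_lt_mu (by lia)) B (e.toLinearMap ∘ₗ π)
      (e.surjective.comp hπ) (fun v hv => hker v (e.map_eq_zero_iff.mp hv)) hz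
  have hAJ : koszulAnn a 1 * J ≤ I := by
    refine Ideal.mul_le.mpr fun s hs t ht => ?_
    refine (Ideal.span_le (I := Submodule.comap (LinearMap.mulLeft R s) I)).mpr ?_ ht
    rintro _ ⟨⟨i, j⟩, rfl⟩
    exact mul_mem_of_mem_koszulAnn hs (c := A.col j) (congrFun h.vecMul_eq_zero j) i
  intro z hz
  refine Ideal.isIntegralElem'_of_sq_mul_mem hx hreg fun w hw => ?_
  have hzw : z ^ 2 * w ∈ (koszulAnn a 1 ^ 2) ^ 2 * J ^ 4 :=
    Ideal.mul_mem_mul (Ideal.pow_mem_pow hz 2) (hJ (pow_two I ▸ hw))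
  rw [← pow_mul, ← mul_pow] at hzw
  rw [← pow_add]
  exact Ideal.pow_right_mono hAJ 4 hzw
end
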